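/- For any odd prime p and any irreducible polynomial P(t) ∈ F_p[t], the quadratic irrational Φ(t) := Θ_p(P(t)) ∈ F_p((t^{-1})) exhibits full maximal escape of mass with respect to the sequence {P(t)^k}_{k≥0}; that is, lim_{n→∞} limsup_{k→∞} (Σ_{i=1}^{ℓ_{Φ·P^k}} max{deg A_i^{[Φ·P^k]} − n, 0}) / (Σ_{i=1}^{ℓ_{Φ·P^k}} deg A_i^{[Φ·P^k]}) = 1. -/

import Mathlib

open scoped Classical
open Filter Polynomial

noncomputable section

namespace EscapeOfMass

variable {K : Type*} [Field K]

/-- The element `t` of `K((t⁻¹))`, modelled as the Laurent series field `K⸨X⸩`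
in the variable `X = t⁻¹`; thus `t = X⁻¹ = single (-1) 1`. -/
def tLS (K : Type*) [Field K] : LaurentSeries K := HahnSeries.single (-1 : ℤ) 1

/-- The polynomial part of a Laurent series in `K((t⁻¹))` (the terms with
non-negative powers of `t`, i.e. non-positive powers of `X`). -/
def polyPart (f : LaurentSeries K) : LaurentSeries K :=
  { coeff := fun n => if n ≤ 0 then f.coeff n else 0
    isPWO_support' := by
      refine f.isPWO_support'.mono fun n hn => ?_
      simp only [Function.mem_support, ne_eq] at hn ⊢
      intro h
      exact hn (by simp [h]) }

/-- The fractional part `⟨f⟩` of a Laurent series in `K((t⁻¹))`. -/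
def fracPart (f : LaurentSeries K) : LaurentSeries K := f - polyPart f

/-- The complete quotients of the continued fraction expansion of `f`. -/
def cfQuot (f : LaurentSeries K) : ℕ → LaurentSeries K
  | 0 => f
  | i + 1 => (cfQuot f i - polyPart (cfQuot f i))⁻¹

/-- The partial quotients `A_i` of the continued fraction expansion of `f`. -/
def cfPQ (f : LaurentSeries K) (i : ℕ) : LaurentSeries K := polyPart (cfQuot f i)

/-- The degree (as an integer) of a Laurent series viewed in `K((t⁻¹))`:
for a nonzero polynomial in `t` this is the usual degree. -/
def degZ (f : LaurentSeries K) : ℤ := -f.order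

/-- `f` is a rational Laurent series, i.e. lies in `K(t)`. -/
def IsRatLS (f : LaurentSeries K) : Prop := ∃ r : RatFunc K, (r : LaurentSeries K) = f

/-- `f` is a quadratic irrational: it is irrational and a root of a quadratic
polynomial with coefficients in `K[t]`. -/
def IsQuadIrr (f : LaurentSeries K) : Prop :=
  ¬ IsRatLS f ∧ ∃ a b c : Polynomial K, a ≠ 0 ∧
    Polynomial.aeval (tLS K) a * f ^ 2 + Polynomial.aeval (tLS K) b * f +
      Polynomial.aeval (tLS K) c = 0

/-- `(m, ℓ)` is a window for the periodic part of the continued fraction of `f`: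
the partial quotients are periodic with period `ℓ ≥ 1` from index `m + 1` on. -/
def PeriodWindow (f : LaurentSeries K) (m ℓ : ℕ) : Prop :=
  1 ≤ ℓ ∧ ∀ i : ℕ, m + 1 ≤ i → cfPQ f (i + ℓ) = cfPQ f i

/-- The `n`-escape of mass of the continued fraction expansion of `f`: the proportion,
within one period of the periodic part of the partial quotients of `f`, of the sum
`∑ max (deg A_i - n) 0` relative to `∑ deg A_i`. -/
def eMassOf (f : LaurentSeries K) (n : ℕ) : ℝ :=
  if h : ∃ s : ℕ × ℕ, PeriodWindow f s.1 s.2 then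
    (∑ i ∈ Finset.Ico ((Classical.choose h).1 + 1)
        ((Classical.choose h).1 + 1 + (Classical.choose h).2),
        max ((degZ (cfPQ f i) : ℝ) - n) 0) /
    (∑ i ∈ Finset.Ico ((Classical.choose h).1 + 1)
        ((Classical.choose h).1 + 1 + (Classical.choose h).2),
        (degZ (cfPQ f i) : ℝ))
  else 0

/-- The `n`-escape of mass in the `k`-th diagonal of `f` with respect to the
sequence `{g^k}`. -/
def eMassP (g f : LaurentSeries K) (k n : ℕ) : ℝ := eMassOf (g ^ k * f) n

/-- The `n`-escape of mass in the `k`-th diagonal of `f` with respect to `{t^k}`. -/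
def eMass (f : LaurentSeries K) (k n : ℕ) : ℝ := eMassP (tLS K) f k n

/-- `f` exhibits `c` escape of mass with respect to the sequence `{g^k}`. -/
def ExhibitsEscape (g f : LaurentSeries K) (c : ℝ) : Prop :=
  ∃ L : ℝ, Tendsto (fun n : ℕ => Filter.liminf (fun k : ℕ => eMassP g f k n) atTop)
    atTop (nhds L) ∧ c ≤ L

/-- `f` exhibits exactly `c` escape of mass with respect to the sequence `{g^k}`. -/
def ExhibitsExactEscape (g f : LaurentSeries K) (c : ℝ) : Prop :=
  Tendsto (fun n : ℕ => Filter.liminf (fun k : ℕ => eMassP g f k n) atTop)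
    atTop (nhds c)

/-- `f` exhibits full (`c = 1`) maximal escape of mass with respect to `{g^k}`. -/
def ExhibitsFullMaxEscape (g f : LaurentSeries K) : Prop :=
  Tendsto (fun n : ℕ => Filter.limsup (fun k : ℕ => eMassP g f k n) atTop)
    atTop (nhds 1)

/-- `A ⊆ ℕ` has natural density `c`. -/
def HasDensity (A : Set ℕ) (c : ℝ) : Prop :=
  Tendsto (fun M : ℕ => (((Finset.Icc 1 M).filter fun k => k ∈ A).card : ℝ) / M)
    atTop (nhds c)

/-- `f` exhibits full generic escape of mass with respect to `{t^k}`. -/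
def FullGenericEscape (f : LaurentSeries K) : Prop :=
  ∀ ε : ℝ, 0 < ε → ∃ dens : ℕ → ℝ,
    (∀ n : ℕ, HasDensity {k : ℕ | 1 - ε < eMass f k n} (dens n)) ∧
    Tendsto dens atTop (nhds 1)

/-- Substitution `t ↦ P(t)` on Laurent series: for `f = ∑_{i ≥ d} a_i t^{-i}` (with
`d = f.order` in the variable `X = t⁻¹`), `substLS f P = ∑_{i ≥ d} a_i P(t)^{-i}`. -/
def substLS (f : LaurentSeries K) (P : Polynomial K) : LaurentSeries K :=
  (Polynomial.aeval (tLS K) P)⁻¹ ^ f.order *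
    HahnSeries.ofPowerSeries ℤ K
      (PowerSeries.mk fun n =>
        ∑ j ∈ Finset.range (n + 1),
          f.coeff (f.order + j) * (((Polynomial.aeval (tLS K) P)⁻¹ ^ j).coeff (n : ℤ)))

/-- The `p`-Cantor sequence over `ZMod p`. -/
def cantor (p : ℕ) : ℕ → ZMod p
  | 0 => 1
  | (n + 1) =>
    if hp : 1 < p then
      if (n + 1) % p % 2 = 1 then 0
      else (((p - 1) / 2).choose (((n + 1) % p) / 2) : ZMod p) * cantor p ((n + 1) / p)
    else 0
  decreasing_by exact Nat.div_lt_self (Nat.succ_pos _) hp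

/-- `Θ̃_p = ∑_{i ≥ 0} c_i^{(p)} t^{-i}`. -/
def cantorTilde (p : ℕ) : LaurentSeries (ZMod p) :=
  HahnSeries.ofPowerSeries ℤ (ZMod p) (PowerSeries.mk fun i => cantor p i)

/-- `Θ_p = t⁻¹ ∑_{i ≥ 0} c_i^{(p)} t^{-i}`. -/
def cantorTheta (p : ℕ) : LaurentSeries (ZMod p) :=
  HahnSeries.single (1 : ℤ) 1 * cantorTilde p

/-- The Thue–Morse sequence over `ZMod 2`. -/
def thueMorse (n : ℕ) : ZMod 2 := ((Nat.digits 2 n).sum : ZMod 2)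

/-- The Thue–Morse Laurent series `τ = ∑_{n ≥ 1} τ_n t^{-n}`. -/
def tmSeries : LaurentSeries (ZMod 2) :=
  HahnSeries.ofPowerSeries ℤ (ZMod 2) (PowerSeries.mk fun n => thueMorse n)

/-- The extension of a one-sided sequence to `ℤ` by zero. -/
def extendSeq (S : ℕ → K) : ℤ → K := fun i => if 0 ≤ i then S i.toNat else 0

/-- The entry `W(S)[m, n]` of the number wall of the (doubly infinite) sequence `s`:
the determinant of the `(m+1) × (m+1)` Toeplitz matrix `(s_{n - i + j})`. -/
def wallEntry (s : ℤ → K) (m : ℕ) (n : ℤ) : K :=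
  (Matrix.of fun i j : Fin (m + 1) => s (n - (i : ℕ) + (j : ℕ))).det

/-- The Laurent series `t⁻¹ ∑_{i ≥ 0} s_i t^{-i}` associated to a sequence. -/
def seriesOf (S : ℕ → K) : LaurentSeries K :=
  HahnSeries.single (1 : ℤ) 1 * HahnSeries.ofPowerSeries ℤ K (PowerSeries.mk S)

/-- The coefficient sequence of `Θ = t⁻¹ ∑ s_i t^{-i}`, extended to `ℤ` by zero. -/
def coeffSeq (f : LaurentSeries K) : ℤ → K := fun i => if 0 ≤ i then f.coeff (i + 1) else 0

/-- The absolute value of a Laurent series in `F_q((t⁻¹))`: `|f| = q^{deg f}`. -/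
def absLS {K : Type*} [Field K] [Fintype K] (f : LaurentSeries K) : ℝ :=
  if f = 0 then 0 else (Fintype.card K : ℝ) ^ (-f.order)


lemma cantor_zero (p : ℕ) : cantor p 0 = 1 := by
  rw [cantor]

lemma cantor_rec (p : ℕ) (hp : 1 < p) (n : ℕ) : cantor p n =
    if n % p % 2 = 1 then 0
      else (((p - 1) / 2).choose ((n % p) / 2) : ZMod p) * cantor p (n / p) := by
  cases n with
  | zero => simp [cantor_zero]
  | succ n => rw [cantor]; simp [hp]

lemma coeff_binom (R : Type*) [CommRing R] (m a : ℕ) :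
    ((1 + PowerSeries.X ^ 2 : PowerSeries R) ^ m).coeff a =
      if 2 ∣ a then (m.choose (a / 2) : R) else 0 := by
  have h : (1 + PowerSeries.X ^ 2 : PowerSeries R) ^ m =
      PowerSeries.expand 2 two_ne_zero (((1 + Polynomial.X : R[X]) ^ m : R[X]) : PowerSeries R) := by
    simp
  rw [h, PowerSeries.coeff_expand, Polynomial.coeff_coe, Polynomial.coeff_one_add_X_pow]

def cantorPS (p : ℕ) : PowerSeries (ZMod p) := PowerSeries.mk fun i => cantor p i

lemma pow_char_eq_expand (p : ℕ) [hp : Fact p.Prime] (f : PowerSeries (ZMod p)) :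
    f ^ p = PowerSeries.expand p hp.out.ne_zero f := by
  have := MvPowerSeries.map_frobenius_expand (σ := Unit) (R := ZMod p) p hp.out.ne_zero (f := f)
  rw [ZMod.frobenius_zmod] at this
  rw [PowerSeries.expand, ← this]
  simp

lemma cantorPS_rec (p : ℕ) [hp : Fact p.Prime] (hodd : Odd p) :
    cantorPS p = (1 + PowerSeries.X ^ 2) ^ ((p - 1) / 2) * (cantorPS p) ^ p := by
  have hp1 := hp.out.one_lt
  ext n
  rw [pow_char_eq_expand, PowerSeries.coeff_mul, cantorPS, PowerSeries.coeff_mk,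
    Finset.sum_eq_single (n % p, p * (n / p))]
  · simp only [PowerSeries.coeff_expand_mul, coeff_binom, PowerSeries.coeff_mk]
    rw [cantor_rec p hp1 n]
    have : (2 ∣ n % p) ↔ ¬ (n % p % 2 = 1) := by omega
    by_cases h : n % p % 2 = 1 <;> simp [this, h]
  · rintro ⟨a, b⟩ hab hne
    rw [Finset.HasAntidiagonal.mem_antidiagonal] at hab
    simp only at hab
    rw [PowerSeries.coeff_expand, coeff_binom]
    by_cases hb : p ∣ b
    · obtain ⟨c, rfl⟩ := hb
      by_cases ha : a < p
      · exfalso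
        apply hne
        have h1 : n % p = a := by rw [← hab, Nat.add_mul_mod_self_left, Nat.mod_eq_of_lt ha]
        have h2 := Nat.mod_add_div n p
        have h4 : p * c = p * (n / p) := by omega
        rw [h1, h4]
      · have : (p - 1) / 2 < a / 2 ∨ ¬ 2 ∣ a := by
          obtain ⟨r, hr⟩ := hodd
          omega
        rcases this with h | h
        · rw [Nat.choose_eq_zero_of_lt h]; simp
        · simp [h]
    · simp [hb]
  · intro h
    exact absurd (Finset.HasAntidiagonal.mem_antidiagonal.2 (Nat.mod_add_div n p)) h

lemma cantorPS_sq (p : ℕ) [hp : Fact p.Prime] (hodd : Odd p) :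
    cantorPS p ^ 2 * (1 + PowerSeries.X ^ 2) = 1 := by
  have hp1 := hp.out.one_lt
  have hrec := cantorPS_rec p hodd
  have hc : PowerSeries.constantCoeff (cantorPS p) = 1 := by
    rw [← PowerSeries.coeff_zero_eq_constantCoeff_apply, cantorPS, PowerSeries.coeff_mk, cantor_zero]
  have hne : cantorPS p ≠ 0 := by
    intro h; rw [h] at hc; simp at hc
  obtain ⟨m, hm⟩ := hodd
  have hm' : (p - 1) / 2 = m := by omega
  rw [hm'] at hrec
  set C := cantorPS p with hC
  set u := C ^ 2 * (1 + PowerSeries.X ^ 2) with hu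
  have hum : u ^ m = 1 := by
    apply mul_left_cancel₀ hne
    rw [mul_one]
    conv_rhs => rw [hrec]
    have h3 : C ^ p = C * (C ^ 2) ^ m := by
      rw [← pow_mul, ← pow_succ', ← hm]
    rw [h3, hu, mul_pow]
    ring
  have hcu : PowerSeries.constantCoeff u = 1 := by
    simp [hu, hc]
  have hg : (u - 1) * (∑ i ∈ Finset.range m, u ^ i) = 0 := by
    rw [mul_comm, geom_sum_mul, hum, sub_self]
  rcases mul_eq_zero.1 hg with h | h
  · exact sub_eq_zero.1 h
  · exfalso
    have h2 := congrArg PowerSeries.constantCoeff h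
    simp [hcu] at h2
    rw [ZMod.natCast_eq_zero_iff] at h2
    have := Nat.le_of_dvd (by omega) h2
    omega

lemma tLS_pow (K : Type*) [Field K] (n : ℕ) :
    tLS K ^ n = HahnSeries.single (-(n : ℤ)) 1 := by
  rw [tLS, HahnSeries.single_pow]; simp

lemma coeff_aeval (a : K[X]) (n : ℤ) : (Polynomial.aeval (tLS K) a).coeff n =
    if n ≤ 0 then a.coeff (-n).toNat else 0 := by
  induction a using Polynomial.induction_on' with
  | add f g hf hg => simp only [map_add, HahnSeries.coeff_add, hf, hg, Polynomial.coeff_add]; split_ifs <;> simp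
  | monomial k c =>
    rw [Polynomial.aeval_monomial, tLS_pow, Polynomial.coeff_monomial]
    have : (algebraMap K (LaurentSeries K)) c = HahnSeries.C c := by
      rw [HahnSeries.algebraMap_apply']
      exact HahnSeries.ofPowerSeries_C c
    rw [this, HahnSeries.C_mul_eq_smul, HahnSeries.coeff_smul, HahnSeries.coeff_single]
    by_cases h : n = -(k:ℤ)
    · subst h; simp
    · have h1 : n ≤ 0 → ¬ (k = (-n).toNat) := by omega
      by_cases h2 : n ≤ 0 <;> simp [h, h2, h1]

lemma order_aeval_le (a : K[X]) (ha : a ≠ 0) :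
    (Polynomial.aeval (tLS K) a).order ≤ -(a.natDegree : ℤ) := by
  apply HahnSeries.order_le_of_coeff_ne_zero
  rw [coeff_aeval]
  simpa using ha

lemma aeval_ne_zero (a : K[X]) (ha : a ≠ 0) : Polynomial.aeval (tLS K) a ≠ 0 := by
  intro h
  have := coeff_aeval a (-(a.natDegree : ℤ))
  rw [h] at this
  simp at this
  exact ha (by simpa using this.symm)

lemma order_inv' (f : LaurentSeries K) : f⁻¹.order = - f.order := by
  by_cases h : f = 0
  · simp [h]
  · have := HahnSeries.order_mul h (inv_ne_zero h)
    rw [mul_inv_cancel₀ h, HahnSeries.order_one] at this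
    omega

lemma polyPart_eq (a : K[X]) (r : LaurentSeries K) (hr : 0 < r.order) :
    polyPart (Polynomial.aeval (tLS K) a + r) = Polynomial.aeval (tLS K) a := by
  ext n
  simp only [polyPart, HahnSeries.coeff_add]
  by_cases hn : n ≤ 0
  · have : r.coeff n = 0 := HahnSeries.coeff_eq_zero_of_lt_order (by omega)
    simp [hn, this]
  · simp [hn, coeff_aeval]

lemma degZ_polyPart_nonneg (f : LaurentSeries K) : 0 ≤ degZ (polyPart f) := by
  by_contra h
  have h1 : 0 < (polyPart f).order := by unfold degZ at h; omega
  have h2 : polyPart f ≠ 0 := by intro h0; rw [h0] at h1; simp at h1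
  apply h2
  rw [← HahnSeries.coeff_order_eq_zero]
  set o := (polyPart f).order
  show (if o ≤ 0 then f.coeff o else 0) = 0
  rw [if_neg (by omega)]

lemma eMassOf_le_one (f : LaurentSeries K) (n : ℕ) : eMassOf f n ≤ 1 := by
  unfold eMassOf
  split_ifs with h
  · apply div_le_one_of_le₀
    · apply Finset.sum_le_sum
      intro i _
      have : (0:ℝ) ≤ degZ (cfPQ f i) := by exact_mod_cast degZ_polyPart_nonneg _
      apply max_le _ this
      have : (0:ℝ) ≤ n := by positivity
      linarith
    · apply Finset.sum_nonneg
      intro i _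
      exact_mod_cast degZ_polyPart_nonneg _
  · norm_num

lemma eMassOf_nonneg (f : LaurentSeries K) (n : ℕ) : 0 ≤ eMassOf f n := by
  unfold eMassOf
  split_ifs with h
  · apply div_nonneg
    · apply Finset.sum_nonneg
      intro i _
      exact le_max_right _ _
    · apply Finset.sum_nonneg
      intro i _
      exact_mod_cast degZ_polyPart_nonneg _
  · norm_num

lemma eMassOf_ge (f : LaurentSeries K) (n : ℕ) (B : ℕ) (hB : 0 < B)
    (hw : ∃ s : ℕ × ℕ, PeriodWindow f s.1 s.2)
    (hd : ∀ i, 1 ≤ i → (B : ℤ) ≤ degZ (cfPQ f i)) : 1 - (n : ℝ) / B ≤ eMassOf f n := by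
  unfold eMassOf
  rw [dif_pos hw]
  obtain ⟨hl, -⟩ := Classical.choose_spec hw
  set m := (Classical.choose hw).1
  set l := (Classical.choose hw).2
  have hB' : (0:ℝ) < B := by exact_mod_cast hB
  have hl' : (0:ℝ) < l := by exact_mod_cast hl
  have h1 : (l : ℝ) * B ≤ ∑ i ∈ Finset.Ico (m + 1) (m + 1 + l), (degZ (cfPQ f i) : ℝ) := by
    have := Finset.card_nsmul_le_sum (Finset.Ico (m + 1) (m + 1 + l))
      (fun i => (degZ (cfPQ f i) : ℝ)) (B : ℝ) (by
        intro i hi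
        have := hd i (by have := (Finset.mem_Ico.1 hi).1; omega)
        exact_mod_cast this)
    simpa using this
  have h2 : ∑ i ∈ Finset.Ico (m + 1) (m + 1 + l), (degZ (cfPQ f i) : ℝ) - l * n ≤
      ∑ i ∈ Finset.Ico (m + 1) (m + 1 + l), max ((degZ (cfPQ f i) : ℝ) - n) 0 := by
    have : ∑ i ∈ Finset.Ico (m + 1) (m + 1 + l), ((degZ (cfPQ f i) : ℝ) - n) ≤
      ∑ i ∈ Finset.Ico (m + 1) (m + 1 + l), max ((degZ (cfPQ f i) : ℝ) - n) 0 :=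
      Finset.sum_le_sum fun i _ => le_max_left _ _
    rw [Finset.sum_sub_distrib] at this
    simpa using this
  set s := ∑ i ∈ Finset.Ico (m + 1) (m + 1 + l), (degZ (cfPQ f i) : ℝ)
  have hs : 0 < s := lt_of_lt_of_le (by positivity) h1
  rw [le_div_iff₀ hs]
  refine le_trans ?_ h2
  have h3 : (l : ℝ) * n ≤ (n / B) * s := by
    rw [div_mul_eq_mul_div, le_div_iff₀ hB']
    have hn : (0:ℝ) ≤ n := by positivity
    nlinarith
  linarith

lemma cantorTheta_order (p : ℕ) [hp : Fact p.Prime] : (cantorTheta p).order = 1 ∧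
    ∀ j : ℕ, (cantorTheta p).coeff (1 + j) = cantor p j := by
  have h2 : ∀ j : ℕ, (cantorTheta p).coeff (1 + j) = cantor p j := by
    intro j
    rw [cantorTheta, HahnSeries.coeff_single_mul, cantorTilde]
    rw [add_sub_cancel_left, HahnSeries.ofPowerSeries_apply_coeff]
    simp
  refine ⟨?_, h2⟩
  have hne : cantorTilde p ≠ 0 := by
    intro h
    have := h2 0
    rw [cantorTheta, h, cantor_zero] at this
    simp at this
  have h0 : (cantorTilde p).coeff 0 ≠ 0 := by
    have := h2 0
    rw [cantorTheta, HahnSeries.coeff_single_mul, cantor_zero] at this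
    simp at this
    rw [this]; exact one_ne_zero
  have h3 : (cantorTilde p).order = 0 := by
    apply le_antisymm
    · exact HahnSeries.order_le_of_coeff_ne_zero h0
    · rw [HahnSeries.le_order_iff_forall hne]
      intro j hj
      rw [cantorTilde, PowerSeries.coeff_coe, if_pos hj]
  rw [cantorTheta, HahnSeries.order_mul (by simp) hne, h3, HahnSeries.order_single one_ne_zero]
  rfl

lemma substLS_sq (p : ℕ) [hp : Fact p.Prime] (hodd : Odd p) (P : (ZMod p)[X])
    (hP : 0 < P.natDegree) :
    substLS (cantorTheta p) P ^ 2 * (Polynomial.aeval (tLS (ZMod p)) P ^ 2 + 1) = 1 := by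
  obtain ⟨h1, h2⟩ := cantorTheta_order p
  have hP0 : P ≠ 0 := by rintro rfl; simp at hP
  have hne := aeval_ne_zero P hP0
  have hord := order_aeval_le P hP0
  unfold substLS
  rw [h1]
  set Q := Polynomial.aeval (tLS (ZMod p)) P
  have hw : 0 < (Q⁻¹).order := by rw [order_inv']; omega
  obtain ⟨w, hw1, hw2⟩ : ∃ w : PowerSeries (ZMod p), PowerSeries.X ∣ w ∧
      HahnSeries.ofPowerSeries ℤ (ZMod p) w = Q⁻¹ := by
    refine ⟨PowerSeries.X ^ (Q⁻¹).order.toNat * LaurentSeries.powerSeriesPart Q⁻¹, ?_, ?_⟩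
    · apply Dvd.dvd.mul_right
      apply dvd_pow_self
      omega
    · have := LaurentSeries.X_order_mul_powerSeriesPart (f := Q⁻¹) (n := (Q⁻¹).order.toNat)
        (by omega)
      exact this
  have hsub : PowerSeries.HasSubst w := by
    apply PowerSeries.HasSubst.of_constantCoeff_zero'
    exact PowerSeries.X_dvd_iff.1 hw1
  have hmk : (PowerSeries.mk fun n =>
        ∑ j ∈ Finset.range (n + 1),
          (cantorTheta p).coeff (1 + j) * ((Q⁻¹ ^ j).coeff (n : ℤ))) =
      PowerSeries.subst w (cantorPS p) := by
    ext n
    rw [PowerSeries.coeff_subst' hsub, PowerSeries.coeff_mk,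
      finsum_eq_sum_of_support_subset (s := Finset.range (n + 1))]
    · apply Finset.sum_congr rfl
      intro j _
      rw [h2, ← hw2, ← map_pow, HahnSeries.ofPowerSeries_apply_coeff, cantorPS,
        PowerSeries.coeff_mk, smul_eq_mul]
    · intro j hj
      by_contra hj'
      apply hj
      have hdvd : PowerSeries.X ^ j ∣ w ^ j := pow_dvd_pow_of_dvd hw1 j
      have : n < j := by simp at hj'; omega
      simp [PowerSeries.X_pow_dvd_iff.1 hdvd n this]
  rw [hmk]
  have key : PowerSeries.subst w (cantorPS p) ^ 2 * (1 + w ^ 2) = 1 := by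
    have := congrArg (PowerSeries.substAlgHom (R := ZMod p) hsub) (cantorPS_sq p hodd)
    rw [map_mul, map_pow, map_add, map_one, map_pow, PowerSeries.substAlgHom_X,
      PowerSeries.coe_substAlgHom] at this
    exact this
  have key2 := congrArg (HahnSeries.ofPowerSeries ℤ (ZMod p)) key
  rw [map_mul, map_pow, map_add, map_one, map_pow, hw2] at key2
  set G := HahnSeries.ofPowerSeries ℤ (ZMod p) (PowerSeries.subst w (cantorPS p))
  have hq : Q⁻¹ * Q = 1 := inv_mul_cancel₀ hne
  rw [zpow_one]
  linear_combination key2 + G ^ 2 * (Q⁻¹ * Q + 1) * hq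

lemma exists_sigma (p : ℕ) [hp : Fact p.Prime] (hodd : Odd p) (P : (ZMod p)[X])
    (hP : 0 < P.natDegree) (Φ : LaurentSeries (ZMod p))
    (hΦ : Φ ^ 2 * (Polynomial.aeval (tLS (ZMod p)) P ^ 2 + 1) = 1) (j : ℕ) (hj : 1 ≤ j) :
    ∃ σ D : (ZMod p)[X], σ.natDegree = (p ^ j - 1) * P.natDegree ∧ σ ≠ 0 ∧ D ≠ 0 ∧
      0 < (Polynomial.aeval (tLS (ZMod p)) P ^ p ^ j * Φ - Polynomial.aeval (tLS (ZMod p)) σ).order ∧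
      (Polynomial.aeval (tLS (ZMod p)) P ^ p ^ j * Φ - Polynomial.aeval (tLS (ZMod p)) σ) *
      (Polynomial.aeval (tLS (ZMod p)) P ^ p ^ j * Φ + Polynomial.aeval (tLS (ZMod p)) σ) *
        Polynomial.aeval (tLS (ZMod p)) D = -1 := by
  obtain ⟨m, hm⟩ : Odd (p ^ j) := hodd.pow
  have hD : (P ^ 2 + 1).natDegree = 2 * P.natDegree := by
    rw [show (1 : (ZMod p)[X]) = Polynomial.C 1 by simp, Polynomial.natDegree_add_C,
      Polynomial.natDegree_pow]
  have hD0 : P ^ 2 + 1 ≠ 0 := by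
    intro h; rw [h] at hD; simp at hD; omega
  set X := Polynomial.aeval (tLS (ZMod p)) P ^ p ^ j * Φ with hX
  set S := (P ^ 2 + 1) ^ m with hS
  have hS0 : S ≠ 0 := pow_ne_zero _ hD0
  have hSd : S.natDegree = (p ^ j - 1) * P.natDegree := by
    rw [hS, Polynomial.natDegree_pow, hD, hm]; simp; ring
  have hpoly : S ^ 2 * (P ^ 2 + 1) = (P ^ p ^ j) ^ 2 + 1 := by
    have : (P ^ 2 + 1) ^ p ^ j = (P ^ 2) ^ p ^ j + 1 := by
      rw [add_pow_char_pow, one_pow]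
    rw [hS, ← pow_mul, ← pow_succ, mul_comm m 2, ← hm, this, ← pow_mul, ← pow_mul, mul_comm]
  have hpoly2 := congrArg (Polynomial.aeval (tLS (ZMod p))) hpoly
  simp only [map_mul, map_pow, map_add, map_one] at hpoly2
  have hDe : Polynomial.aeval (tLS (ZMod p)) (P ^ 2 + 1) =
    Polynomial.aeval (tLS (ZMod p)) P ^ 2 + 1 := by simp
  have hprod : (X - Polynomial.aeval (tLS (ZMod p)) S) * (X + Polynomial.aeval (tLS (ZMod p)) S) *
      Polynomial.aeval (tLS (ZMod p)) (P ^ 2 + 1) = -1 := by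
    rw [hDe, hX]
    linear_combination (Polynomial.aeval (tLS (ZMod p)) P ^ p ^ j) ^ 2 * hΦ - hpoly2
  have hn1 : X - Polynomial.aeval (tLS (ZMod p)) S ≠ 0 := by
    intro h; rw [h] at hprod; simp at hprod
  have hn2 : X + Polynomial.aeval (tLS (ZMod p)) S ≠ 0 := by
    intro h; rw [h] at hprod; simp at hprod
  have ho := congrArg HahnSeries.order hprod
  rw [HahnSeries.order_mul (mul_ne_zero hn1 hn2) (aeval_ne_zero _ hD0), HahnSeries.order_mul hn1 hn2,
    HahnSeries.order_neg, HahnSeries.order_one] at ho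
  have hoD := order_aeval_le _ hD0
  rw [hD] at hoD
  by_cases hc : 0 < (X - Polynomial.aeval (tLS (ZMod p)) S).order
  · exact ⟨S, P ^ 2 + 1, hSd, hS0, hD0, hc, hprod⟩
  · refine ⟨-S, P ^ 2 + 1, by simpa using hSd, by simpa using hS0, hD0, ?_, ?_⟩
    · rw [map_neg, sub_neg_eq_add]; omega
    · rw [map_neg, ← hprod]; ring

lemma cf_structure (hK : (2 : K) ≠ 0) (X : LaurentSeries K) (σ D : K[X]) (hσ : σ ≠ 0) (hD : D ≠ 0)
    (hd : 0 < σ.natDegree)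
    (ho : 0 < (X - Polynomial.aeval (tLS K) σ).order)
    (h : (X - Polynomial.aeval (tLS K) σ) * (X + Polynomial.aeval (tLS K) σ) *
        Polynomial.aeval (tLS K) D = -1) :
    PeriodWindow X 0 2 ∧ ∀ i, 1 ≤ i → (σ.natDegree : ℤ) ≤ degZ (cfPQ X i) := by
  set s := Polynomial.aeval (tLS K) σ with hs
  set d := Polynomial.aeval (tLS K) D with hdd
  have h2σ : Polynomial.C 2 * σ ≠ 0 := mul_ne_zero (by simpa using hK) hσ
  have h2d : (Polynomial.C 2 * σ).natDegree = σ.natDegree := Polynomial.natDegree_C_mul hK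
  have e2 : Polynomial.aeval (tLS K) (Polynomial.C 2 * σ) = 2 * s := by
    rw [map_mul, Polynomial.aeval_C, map_ofNat]
  have e3 : Polynomial.aeval (tLS K) (-(Polynomial.C 2 * σ * D)) = -(2 * s * d) := by
    rw [map_neg, map_mul, e2]
  have hZ0 : X + s ≠ 0 := by
    intro h0; rw [h0] at h; simp at h
  have hY0 : X - s ≠ 0 := by
    intro h0; rw [h0] at h; simp at h
  have hd0 : d ≠ 0 := aeval_ne_zero _ hD
  have hZ : X + s = Polynomial.aeval (tLS K) (Polynomial.C 2 * σ) + (X - s) := by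
    rw [e2]; ring
  have hW : -(d * (X + s)) = Polynomial.aeval (tLS K) (-(Polynomial.C 2 * σ * D)) + (X + s)⁻¹ := by
    rw [e3]; field_simp; linear_combination -h
  have hZo : (X + s).order < 0 := by
    have : (X + s).order ≤ -(σ.natDegree : ℤ) := by
      apply HahnSeries.order_le_of_coeff_ne_zero
      rw [hZ, HahnSeries.coeff_add, HahnSeries.coeff_eq_zero_of_lt_order (x := X - s) (by omega),
        coeff_aeval, ← h2d]
      simpa using ⟨hK, hσ⟩
    omega
  have hZi : 0 < (X + s)⁻¹.order := by rw [order_inv']; omega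
  have pZ : polyPart (X + s) = 2 * s := by rw [hZ, polyPart_eq _ _ ho, e2]
  have pW : polyPart (-(d * (X + s))) = -(2 * s * d) := by rw [hW, polyPart_eq _ _ hZi, e3]
  have hYi : (X - s)⁻¹ = -(d * (X + s)) := by
    apply inv_eq_of_mul_eq_one_right
    linear_combination -h
  have q1 : cfQuot X 1 = -(d * (X + s)) := by
    have : X = s + (X - s) := by ring
    have h5 : polyPart X = s := by
      conv_lhs => rw [this]
      rw [hs, polyPart_eq _ _ ho]
    simp only [cfQuot]
    rw [h5, hYi]
  have q : ∀ i, cfQuot X (2 * i + 1) = -(d * (X + s)) ∧ cfQuot X (2 * i + 2) = X + s := by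
    have st : ∀ i, cfQuot X i = -(d * (X + s)) → cfQuot X (i + 1) = X + s := by
      intro i hi
      rw [cfQuot, hi, pW, hW, e3, add_sub_cancel_left, inv_inv]
    intro i
    induction i with
    | zero => exact ⟨q1, st 1 q1⟩
    | succ i ih =>
      have : cfQuot X (2 * (i + 1) + 1) = -(d * (X + s)) := by
        show cfQuot X ((2 * i + 2) + 1) = _
        rw [cfQuot, ih.2, pZ, ← hYi]
        congr 1; ring
      exact ⟨this, st _ this⟩
  refine ⟨⟨by norm_num, ?_⟩, ?_⟩
  · intro i hi
    obtain ⟨k, hk⟩ : ∃ k, i = 2 * k + 1 ∨ i = 2 * k + 2 := ⟨(i - 1) / 2, by omega⟩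
    unfold cfPQ
    rcases hk with rfl | rfl
    · rw [(q k).1, show 2 * k + 1 + 2 = 2 * (k + 1) + 1 by ring, (q (k + 1)).1]
    · rw [(q k).2, show 2 * k + 2 + 2 = 2 * (k + 1) + 2 by ring, (q (k + 1)).2]
  · intro i hi
    obtain ⟨k, hk⟩ : ∃ k, i = 2 * k + 1 ∨ i = 2 * k + 2 := ⟨(i - 1) / 2, by omega⟩
    unfold cfPQ degZ
    rcases hk with rfl | rfl
    · rw [(q k).1, pW, ← e3]
      have := order_aeval_le (-(Polynomial.C 2 * σ * D)) (neg_ne_zero.2 (mul_ne_zero h2σ hD))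
      rw [Polynomial.natDegree_neg, Polynomial.natDegree_mul h2σ hD, h2d] at this
      push_cast at this
      omega
    · rw [(q k).2, pZ, ← e2]
      have := order_aeval_le _ h2σ
      rw [h2d] at this
      omega

/-- For any odd prime `p` and irreducible `P ∈ F_p[t]`, the quadratic
irrational `Φ = Θ_p(P(t))` exhibits full maximal escape of mass w.r.t. `{P(t)^k}`. -/
theorem pCantor_full_maximal_escape (p : ℕ) [Fact p.Prime] (hodd : Odd p)
    (P : Polynomial (ZMod p)) (hP : Irreducible P) :
    ExhibitsFullMaxEscape (Polynomial.aeval (tLS (ZMod p)) P)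
      (substLS (cantorTheta p) P) := by
  have hp : p.Prime := Fact.out
  have hdeg : 0 < P.natDegree := hP.natDegree_pos
  have hK : (2 : ZMod p) ≠ 0 := by
    intro h
    have h2 : ((2 : ℕ) : ZMod p) = 0 := by exact_mod_cast h
    rw [ZMod.natCast_eq_zero_iff] at h2
    have h3 := Nat.le_of_dvd (by norm_num) h2
    have h4 := hp.two_le
    obtain ⟨m, hm⟩ := hodd
    omega
  have hΦ := substLS_sq p hodd P hdeg
  unfold ExhibitsFullMaxEscape
  suffices hlim : ∀ n : ℕ, Filter.limsup (fun k : ℕ => eMassP (Polynomial.aeval (tLS (ZMod p)) P)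
      (substLS (cantorTheta p) P) k n) atTop = 1 by
    simp only [hlim]
    exact tendsto_const_nhds
  intro n
  have hbd : IsBoundedUnder (· ≤ ·) atTop (fun k : ℕ => eMassP (Polynomial.aeval (tLS (ZMod p)) P)
      (substLS (cantorTheta p) P) k n) :=
    isBoundedUnder_of ⟨1, fun k => eMassOf_le_one _ _⟩
  have hbd' : IsBoundedUnder (· ≥ ·) atTop (fun k : ℕ => eMassP (Polynomial.aeval (tLS (ZMod p)) P)
      (substLS (cantorTheta p) P) k n) :=
    isBoundedUnder_of ⟨0, fun k => eMassOf_nonneg _ _⟩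
  apply le_antisymm
  · exact limsup_le_of_le hbd'.isCoboundedUnder_le
      (Eventually.of_forall fun k => eMassOf_le_one _ _)
  · apply le_of_forall_sub_le
    intro ε hε
    apply le_limsup_of_frequently_le _ hbd
    rw [frequently_atTop]
    intro N
    obtain ⟨M, hM⟩ := exists_nat_gt ((n : ℝ) / ε)
    set j := N + M + 1 with hj
    have hjp : j < p ^ j := Nat.lt_pow_self hp.one_lt
    refine ⟨p ^ j, by omega, ?_⟩
    obtain ⟨σ, D, h1, h2, h3, h4, h5⟩ := exists_sigma p hodd P hdeg _ hΦ j (by omega)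
    have hB : M + 1 ≤ σ.natDegree := by
      rw [h1]
      have : M + 1 ≤ p ^ j - 1 := by omega
      nlinarith
    obtain ⟨c1, c2⟩ := cf_structure hK _ σ D h2 h3 (by omega) h4 h5
    refine le_trans ?_ (eMassOf_ge _ n σ.natDegree (by omega) ⟨(0, 2), c1⟩ c2)
    have hB' : (M : ℝ) + 1 ≤ σ.natDegree := by exact_mod_cast hB
    have hM0 : (0 : ℝ) ≤ M := by positivity
    have : (n : ℝ) / σ.natDegree ≤ ε := by
      rw [div_le_iff₀ (by linarith)]
      rw [div_lt_iff₀ hε] at hM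
      nlinarith
    linarith

end EscapeOfMass
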